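/- The e-adjacency tensor determines the hypergraph: if E₁ and E₂ are two hyperedge families on Fin n (each consisting of nonempty subsets of Fin n of cardinality at most k) whose e-adjacency tensors, built with the same parameters n and k, are equal as functions (Fin k → Fin N) → ℝ, then E₁ = E₂. In other words, the map sending a hypergraph to its e-adjacency tensor is injective, so the original hypergraph can be reconstructed from its e-adjacency tensor. -/

import Mathlib

open Finset

/-- Embedding of the original vertices `Fin n` into the extended vertex set `Fin (n + k - 1)`. -/
def emb (n k : ℕ) (hk : 1 ≤ k) (v : Fin n) : Fin (n + k - 1) :=
  ⟨(v : ℕ), by have := v.isLt; omega⟩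

/-- The additional vertex `y_{j+1}` corresponds to the index `n + j` of `Fin (n + k - 1)`. -/
def addIdx (n k : ℕ) (j : Fin (k - 1)) : Fin (n + k - 1) :=
  ⟨n + (j : ℕ), by have := j.isLt; omega⟩

/-- The set of additional indices `{n+s-1, ..., n+k-2}` used to fill a hyperedge `e`
of cardinality `s`. -/
def addSet (n k : ℕ) (e : Finset (Fin n)) : Finset (Fin (n + k - 1)) :=
  (Finset.univ.filter fun j : Fin (k - 1) => e.card - 1 ≤ (j : ℕ)).image (addIdx n k)

/-- The filled hyperedge `ê ⊆ Fin (n + k - 1)` of a hyperedge `e ⊆ Fin n`. -/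
def filled (n k : ℕ) (hk : 1 ≤ k) (e : Finset (Fin n)) : Finset (Fin (n + k - 1)) :=
  e.image (emb n k hk) ∪ addSet n k e

/-- The e-adjacency tensor of the hypergraph with hyperedge family `E`:
`r t = 1/(k-1)!` if `t` is injective with image a filled hyperedge, and `0` otherwise. -/
noncomputable def eAdj (n k : ℕ) (hk : 1 ≤ k) (E : Finset (Finset (Fin n))) :
    (Fin k → Fin (n + k - 1)) → ℝ := fun t =>
  if Function.Injective t ∧ ∃ e ∈ E, Finset.image t Finset.univ = filled n k hk e then
    1 / (Nat.factorial (k - 1)) else 0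

/-- The degree of a vertex `v`: the number of hyperedges containing `v`. -/
def deg (n : ℕ) (E : Finset (Finset (Fin n))) (v : Fin n) : ℕ :=
  (E.filter fun e => v ∈ e).card

/-- The tuple `(i, t 0, ..., t (m-2)) : Fin m → Fin N`. -/
def extend (m N : ℕ) (i : Fin N) (t : Fin (m - 1) → Fin N) : Fin m → Fin N :=
  fun j => if h : (j : ℕ) = 0 then i else t ⟨(j : ℕ) - 1, by have := j.isLt; omega⟩

/-- `(lam, x)` is an eigenpair of the order-`m`, dimension-`N` hypermatrix `T`. -/
def IsEigenpair (m N : ℕ) (T : (Fin m → Fin N) → ℝ) (lam : ℂ) (x : Fin N → ℂ) : Prop :=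
  x ≠ 0 ∧ ∀ i : Fin N,
    ∑ t : Fin (m - 1) → Fin N, (T (extend m N i t) : ℂ) * ∏ j : Fin (m - 1), x (t j)
      = lam * x i ^ (m - 1)


theorem emb_injective (n k : ℕ) (hk : 1 ≤ k) : Function.Injective (emb n k hk) := fun a b h => by
  simpa [emb, Fin.ext_iff] using h

theorem addIdx_injective (n k : ℕ) : Function.Injective (addIdx n k) := fun a b h => by
  simpa [addIdx, Fin.ext_iff] using h

theorem emb_ne_addIdx (n k : ℕ) (hk : 1 ≤ k) (v : Fin n) (j : Fin (k - 1)) :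
    emb n k hk v ≠ addIdx n k j := fun h => by
  have := v.isLt
  simp only [emb, addIdx, Fin.mk.injEq] at h
  omega

theorem emb_mem_filled (n k : ℕ) (hk : 1 ≤ k) (e : Finset (Fin n)) (v : Fin n) :
    emb n k hk v ∈ filled n k hk e ↔ v ∈ e := by
  have hadd : emb n k hk v ∉ addSet n k e := fun h => by
    obtain ⟨j, -, hj⟩ := mem_image.1 h
    exact emb_ne_addIdx n k hk v j hj.symm
  rw [filled, mem_union, or_iff_left hadd, (emb_injective n k hk).mem_finset_image]

theorem filled_injective (n k : ℕ) (hk : 1 ≤ k) : Function.Injective (filled n k hk) :=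
  fun e f h => by
    ext v
    rw [← emb_mem_filled n k hk e, h, emb_mem_filled]

theorem card_addSet (n k : ℕ) (e : Finset (Fin n)) :
    (addSet n k e).card = k - 1 - (e.card - 1) := by
  rw [addSet, card_image_of_injective _ (addIdx_injective n k), ← card_map Fin.valEmbedding,
    ← Nat.card_Ico (e.card - 1) (k - 1)]
  congr 1
  ext a
  simp only [mem_map, mem_filter, mem_univ, true_and, Fin.valEmbedding_apply, mem_Ico]
  exact ⟨by rintro ⟨j, hj, rfl⟩; exact ⟨hj, j.isLt⟩, fun ha => ⟨⟨a, ha.2⟩, ha.1, rfl⟩⟩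

theorem card_filled (n k : ℕ) (hk : 1 ≤ k) (e : Finset (Fin n)) (he : e.Nonempty)
    (hek : e.card ≤ k) : (filled n k hk e).card = k := by
  have hdisj : Disjoint (e.image (emb n k hk)) (addSet n k e) := by
    simp only [disjoint_left, addSet, mem_image, not_exists, not_and]
    rintro _ ⟨v, -, rfl⟩ j - hj
    exact emb_ne_addIdx n k hk v j hj.symm
  have := he.card_pos
  rw [filled, card_union_of_disjoint hdisj, card_image_of_injective _ (emb_injective n k hk),
    card_addSet]
  omega

theorem eAdj_ne_zero_iff (n k : ℕ) (hk : 1 ≤ k) (E : Finset (Finset (Fin n)))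
    (t : Fin k → Fin (n + k - 1)) :
    eAdj n k hk E t ≠ 0 ↔
      Function.Injective t ∧ ∃ e ∈ E, Finset.image t Finset.univ = filled n k hk e := by
  simp [eAdj, Nat.factorial_ne_zero]

/-- If two families have the same e-adjacency tensor, each hyperedge of the first lies in the second:
an enumeration of its filled hyperedge lies in the support of the tensor. -/
theorem subset_of_eAdj_eq (n k : ℕ) (hk : 1 ≤ k) (E F : Finset (Finset (Fin n)))
    (hE : ∀ e ∈ E, e.Nonempty) (hEk : ∀ e ∈ E, e.card ≤ k)
    (h : eAdj n k hk E = eAdj n k hk F) : E ⊆ F := fun e he => by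
  have hcard := card_filled n k hk e (hE e he) (hEk e he)
  let t := (filled n k hk e).orderEmbOfFin hcard
  have ht : Finset.image t Finset.univ = filled n k hk e :=
    Finset.image_orderEmbOfFin_univ _ hcard
  have hne := (eAdj_ne_zero_iff n k hk E t).2 ⟨t.injective, e, he, ht⟩
  rw [h, eAdj_ne_zero_iff] at hne
  obtain ⟨-, f, hf, hft⟩ := hne
  rwa [filled_injective n k hk (ht.symm.trans hft)]

/-- The e-adjacency tensor determines the hypergraph: two hyperedge families on `Fin n`
(consisting of nonempty subsets of cardinality at most `k`) with equal e-adjacency tensors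
are equal; i.e. the map from hypergraphs to e-adjacency tensors is injective. -/
theorem eAdj_injective (n k : ℕ) (hn : 1 ≤ n) (hk : 2 ≤ k)
    (E₁ E₂ : Finset (Finset (Fin n)))
    (hE₁1 : ∀ e ∈ E₁, e.Nonempty) (hE₁2 : ∀ e ∈ E₁, e.card ≤ k)
    (hE₂1 : ∀ e ∈ E₂, e.Nonempty) (hE₂2 : ∀ e ∈ E₂, e.card ≤ k)
    (h : eAdj n k (by omega) E₁ = eAdj n k (by omega) E₂) :
    E₁ = E₂ := by
  exact (subset_of_eAdj_eq n k (by omega) E₁ E₂ hE₁1 hE₁2 h).antisymm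
    (subset_of_eAdj_eq n k (by omega) E₂ E₁ hE₂1 hE₂2 h.symm)
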